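/- arXiv:2111.05281 — 2 statements merged into one kernel-verified Lean document; each statement's English description precedes it below -/
import Mathlib

section
/- Let N ≥ 1 be an integer, and let (x_{1,i})_{i=1}^∞, …, (x_{N,i})_{i=1}^∞ be N positive nondecreasing real sequences satisfying c_A·A^i ≤ x_{j,i} ≤ c_B·i^R·B^i for all i ≥ 1 and all 1 ≤ j ≤ N, where R ≥ 0, c_A, c_B > 0 and A, B > 1 are given constants. Let (y_i)_{i=1}^∞ be a nondecreasing sequence such that y_i = x_{e(i)} for some bijection e from {1, 2, 3, …} to {1,…,N} × {1, 2, 3, …} (i.e., (y_i) merges all N sequences and sorts the resulting values in nondecreasing order). Then A^{1/N} ≤ liminf_{i→∞} y_i^{1/i} ≤ limsup_{i→∞} y_i^{1/i} ≤ B^{1/N}. -/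
open Filter

theorem aux_lower (N : ℕ) (hN : 1 ≤ N)
    (e : {n : ℕ // 1 ≤ n} ≃ Fin N × {n : ℕ // 1 ≤ n}) (n : ℕ) (hn : 1 ≤ n) :
    ∃ m : {n : ℕ // 1 ≤ n}, m.1 ≤ n ∧ n ≤ N * (e m).2.1 := by
  by_contra! H
  have hlt : ∀ m : Fin n, (e ⟨m.1 + 1, by omega⟩).2.1 - 1 < (n - 1) / N := by
    intro m
    have h1 := H ⟨m.1 + 1, by omega⟩ m.2
    have h2 := (e ⟨m.1 + 1, by omega⟩).2.2
    have h3 : (e ⟨m.1 + 1, by omega⟩).2.1 ≤ (n - 1) / N := by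
      rw [Nat.le_div_iff_mul_le (by omega), mul_comm]
      omega
    omega
  let f : Fin n → Fin N × Fin ((n - 1) / N) := fun m =>
    ((e ⟨m.1 + 1, by omega⟩).1, ⟨_, hlt m⟩)
  have hf : Function.Injective f := by
    intro a b hab
    simp only [f, Prod.mk.injEq, Fin.mk.injEq] at hab
    have ha := (e ⟨a.1 + 1, by omega⟩).2.2
    have hb := (e ⟨b.1 + 1, by omega⟩).2.2
    have : e ⟨a.1 + 1, by omega⟩ = e ⟨b.1 + 1, by omega⟩ := by
      apply Prod.ext hab.1
      apply Subtype.ext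
      omega
    have := congrArg Subtype.val (e.injective this)
    simp only at this
    exact Fin.ext (by omega)
  have hc := Fintype.card_le_of_injective f hf
  simp only [Fintype.card_prod, Fintype.card_fin] at hc
  have := Nat.mul_div_le (n - 1) N
  omega

theorem aux_upper (N : ℕ) (hN : 1 ≤ N)
    (e : {n : ℕ // 1 ≤ n} ≃ Fin N × {n : ℕ // 1 ≤ n}) (n : ℕ) (hn : 1 ≤ n) :
    ∃ m : {n : ℕ // 1 ≤ n}, n ≤ m.1 ∧ (e m).2.1 ≤ n / N + 1 := by
  by_contra! H
  have hlt : ∀ p : Fin N × Fin (n / N + 1),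
      (e.symm (p.1, ⟨p.2.1 + 1, by omega⟩)).1 - 1 < n - 1 := by
    intro p
    have h2 := (e.symm (p.1, ⟨p.2.1 + 1, by omega⟩)).2
    by_contra! h
    have h1 := H (e.symm (p.1, ⟨p.2.1 + 1, by omega⟩)) (by omega)
    simp only [Equiv.apply_symm_apply] at h1
    have := p.2.2
    omega
  let f : Fin N × Fin (n / N + 1) → Fin (n - 1) := fun p => ⟨_, hlt p⟩
  have hf : Function.Injective f := by
    intro a b hab
    simp only [f, Fin.mk.injEq] at hab
    have ha := (e.symm (a.1, ⟨a.2.1 + 1, by omega⟩)).2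
    have hb := (e.symm (b.1, ⟨b.2.1 + 1, by omega⟩)).2
    have : e.symm (a.1, ⟨a.2.1 + 1, by omega⟩) = e.symm (b.1, ⟨b.2.1 + 1, by omega⟩) := by
      apply Subtype.ext
      omega
    have := e.symm.injective this
    simp only [Prod.mk.injEq, Subtype.mk.injEq] at this
    exact Prod.ext this.1 (Fin.ext (by omega))
  have hc := Fintype.card_le_of_injective f hf
  simp only [Fintype.card_prod, Fintype.card_fin] at hc
  have := Nat.lt_mul_div_succ n (show 0 < N by omega)
  omega

theorem aux_const (c : ℝ) (hc : 0 < c) :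
    Tendsto (fun n : ℕ => c ^ (1 / (n : ℝ))) atTop (nhds 1) := by
  have h := (tendsto_one_div_atTop_nhds_zero_nat (𝕜 := ℝ))
  have := (Real.continuousAt_const_rpow (a := c) (b := 0) hc.ne').tendsto.comp h
  simpa [Function.comp_def] using this

theorem aux_n : Tendsto (fun n : ℕ => (n : ℝ) ^ (1 / (n : ℝ))) atTop (nhds 1) := by
  exact tendsto_rpow_div.comp tendsto_natCast_atTop_atTop

theorem stmt_12 (N : ℕ) (hN : 1 ≤ N) (R cA cB A B : ℝ)
    (hR : 0 ≤ R) (hcA : 0 < cA) (hcB : 0 < cB) (hA : 1 < A) (hB : 1 < B)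
    (x : Fin N → ℕ → ℝ)
    (hpos : ∀ j, ∀ i : ℕ, 1 ≤ i → 0 < x j i)
    (hmono : ∀ j, ∀ i i' : ℕ, 1 ≤ i → i ≤ i' → x j i ≤ x j i')
    (hbound : ∀ j, ∀ i : ℕ, 1 ≤ i →
      cA * A ^ (i : ℝ) ≤ x j i ∧ x j i ≤ cB * (i : ℝ) ^ R * B ^ (i : ℝ))
    (y : ℕ → ℝ)
    (hymono : ∀ i i' : ℕ, 1 ≤ i → i ≤ i' → y i ≤ y i')
    (e : {n : ℕ // 1 ≤ n} ≃ Fin N × {n : ℕ // 1 ≤ n})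
    (he : ∀ n : {n : ℕ // 1 ≤ n}, y n.1 = x (e n).1 (e n).2.1) :
    A ^ (1 / (N : ℝ)) ≤ Filter.liminf (fun i : ℕ => y i ^ (1 / (i : ℝ))) Filter.atTop ∧
    Filter.liminf (fun i : ℕ => y i ^ (1 / (i : ℝ))) Filter.atTop ≤
      Filter.limsup (fun i : ℕ => y i ^ (1 / (i : ℝ))) Filter.atTop ∧
    Filter.limsup (fun i : ℕ => y i ^ (1 / (i : ℝ))) Filter.atTop ≤ B ^ (1 / (N : ℝ)) := by
  have hN' : (0 : ℝ) < N := by exact_mod_cast hN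
  have hlow : ∀ n : ℕ, 1 ≤ n → cA * A ^ ((n : ℝ) / N) ≤ y n := by
    intro n hn
    obtain ⟨m, hm, hk⟩ := aux_lower N hN e n hn
    refine le_trans ?_ (hymono m.1 n m.2 hm)
    rw [he m]
    refine le_trans ?_ (hbound _ _ (e m).2.2).1
    have : (n : ℝ) / N ≤ ((e m).2.1 : ℝ) := by
      rw [div_le_iff₀ hN', mul_comm]
      exact_mod_cast hk
    gcongr
    exact hA.le
  have hup : ∀ n : ℕ, 1 ≤ n → y n ≤ cB * (2 * (n : ℝ)) ^ R * B ^ ((n : ℝ) / N + 1) := by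
    intro n hn
    obtain ⟨m, hm, hk⟩ := aux_upper N hN e n hn
    refine le_trans (hymono n m.1 hn hm) ?_
    rw [he m]
    refine le_trans (hbound _ _ (e m).2.2).2 ?_
    have h1 : ((e m).2.1 : ℝ) ≤ (n : ℝ) / N + 1 := by
      have h2 : ((e m).2.1 : ℝ) ≤ ((n / N : ℕ) : ℝ) + 1 := by exact_mod_cast hk
      have h3 : ((n / N : ℕ) : ℝ) ≤ (n : ℝ) / N := Nat.cast_div_le
      linarith
    have h4 : ((e m).2.1 : ℝ) ≤ 2 * (n : ℝ) := by
      have := Nat.div_le_self n N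
      have h5 : (e m).2.1 ≤ 2 * n := by omega
      exact_mod_cast h5
    gcongr
    exact hB.le
  have hlow' : ∀ᶠ n : ℕ in atTop,
      cA ^ (1 / (n : ℝ)) * A ^ (1 / (N : ℝ)) ≤ y n ^ (1 / (n : ℝ)) := by
    filter_upwards [eventually_ge_atTop 1] with n hn
    have hn' : (0 : ℝ) < n := by exact_mod_cast hn
    have h := Real.rpow_le_rpow (by positivity) (hlow n hn)
      (show (0 : ℝ) ≤ 1 / (n : ℝ) by positivity)
    rw [Real.mul_rpow (by positivity) (by positivity), ← Real.rpow_mul (by positivity)] at h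
    rwa [show (n : ℝ) / N * (1 / n) = 1 / N by field_simp] at h
  have hup' : ∀ᶠ n : ℕ in atTop, y n ^ (1 / (n : ℝ)) ≤
      cB ^ (1 / (n : ℝ)) * (2 ^ (1 / (n : ℝ)) * (n : ℝ) ^ (1 / (n : ℝ))) ^ R
        * (B ^ (1 / (N : ℝ)) * B ^ (1 / (n : ℝ))) := by
    filter_upwards [eventually_ge_atTop 1] with n hn
    have hn' : (0 : ℝ) < n := by exact_mod_cast hn
    have hy : 0 ≤ y n := le_trans (by positivity) (hlow n hn)
    have h := Real.rpow_le_rpow hy (hup n hn)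
      (show (0 : ℝ) ≤ 1 / (n : ℝ) by positivity)
    rw [Real.mul_rpow (by positivity) (by positivity),
      Real.mul_rpow (by positivity) (by positivity), ← Real.rpow_mul (by positivity),
      ← Real.rpow_mul (by positivity), mul_comm R, Real.rpow_mul (by positivity),
      Real.mul_rpow (by positivity) (by positivity),
      show ((n : ℝ) / N + 1) * (1 / n) = 1 / N + 1 / n by field_simp,
      Real.rpow_add (by positivity)] at h
    exact h
  have tlow : Tendsto (fun n : ℕ => cA ^ (1 / (n : ℝ)) * A ^ (1 / (N : ℝ))) atTop
      (nhds (A ^ (1 / (N : ℝ)))) := by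
    simpa using (aux_const cA hcA).mul_const (A ^ (1 / (N : ℝ)))
  have tup : Tendsto (fun n : ℕ =>
      cB ^ (1 / (n : ℝ)) * (2 ^ (1 / (n : ℝ)) * (n : ℝ) ^ (1 / (n : ℝ))) ^ R
        * (B ^ (1 / (N : ℝ)) * B ^ (1 / (n : ℝ)))) atTop (nhds (B ^ (1 / (N : ℝ)))) := by
    have h1 := ((aux_const 2 two_pos).mul aux_n).rpow_const (p := R) (Or.inr hR)
    have h2 := ((aux_const cB hcB).mul h1).mul
      ((aux_const B (by positivity)).const_mul (B ^ (1 / (N : ℝ))))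
    simpa only [mul_one, one_mul, Real.one_rpow] using h2
  have bup : IsBoundedUnder (· ≤ ·) atTop (fun i : ℕ => y i ^ (1 / (i : ℝ))) :=
    tup.isBoundedUnder_le.mono_le hup'
  have blow : IsBoundedUnder (· ≥ ·) atTop (fun i : ℕ => y i ^ (1 / (i : ℝ))) :=
    tlow.isBoundedUnder_ge.mono_ge hlow'
  refine ⟨?_, liminf_le_limsup bup blow, ?_⟩
  · rw [← tlow.liminf_eq]
    exact liminf_le_liminf hlow' tlow.isBoundedUnder_ge bup.isCoboundedUnder_ge
  · rw [← tup.limsup_eq]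
    exact limsup_le_limsup hup' blow.isCoboundedUnder_le tup.isBoundedUnder_le
end

section
/- Let r ≥ 4, and let p ≥ 1 and 0 ≤ f < p be integers. Let X_0, …, X_{p−1} be r-robust schedules, and suppose the real number ρ is an upper bound on the f-fault-tolerant acceleration ratio of the p-processor schedule defined by X_0, …, X_{p−1}. Then ρ ≥ inf { b^{p+f+1}/(b^p − 1) : ζ_{1,r}^{1/p} ≤ b ≤ ζ_{2,r}^{1/p} }. -/
open Finset

/-- A schedule: a strictly increasing sequence of positive reals. -/
def IsSchedule (X : ℕ → ℝ) : Prop := StrictMono X ∧ ∀ i, 0 < X i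

/-- `ℓ(X,T)`: the largest contract length of `X` completed by time `T`. -/
noncomputable def ell (X : ℕ → ℝ) (T : ℝ) : ℝ :=
  sSup {y : ℝ | ∃ i : ℕ, y = X i ∧ ∑ j ∈ Finset.range (i + 1), X j ≤ T}

/-- An `r`-robust schedule. -/
def IsRobust (r : ℝ) (X : ℕ → ℝ) : Prop :=
  X 0 ≤ r ∧ ∀ n : ℕ, 1 ≤ n → ∑ j ∈ Finset.range (n + 1), X j ≤ r * X (n - 1)

/-- The smaller root of `x² - r·x + r = 0`. -/
noncomputable def zeta1 (r : ℝ) : ℝ := (r - Real.sqrt (r ^ 2 - 4 * r)) / 2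

/-- The larger root of `x² - r·x + r = 0`. -/
noncomputable def zeta2 (r : ℝ) : ℝ := (r + Real.sqrt (r ^ 2 - 4 * r)) / 2

lemma zeta_facts (r : ℝ) (hr : 4 ≤ r) :
    1 < zeta1 r ∧ zeta1 r ≤ zeta2 r ∧
      ∀ L : ℝ, L ^ 2 ≤ r * (L - 1) → zeta1 r ≤ L ∧ L ≤ zeta2 r := by
  have h0 : 0 ≤ r ^ 2 - 4 * r := by nlinarith
  have hs := Real.sq_sqrt h0
  have hs0 := Real.sqrt_nonneg (r ^ 2 - 4 * r)
  unfold zeta1 zeta2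
  set s := Real.sqrt (r ^ 2 - 4 * r)
  refine ⟨?_, ?_, ?_⟩
  · have : s < r - 2 := by
      apply lt_of_pow_lt_pow_left₀ 2 (by linarith)
      nlinarith
    linarith
  · linarith
  · intro L hL
    have h : (2 * L - r) ^ 2 ≤ s ^ 2 := by nlinarith
    have := abs_le_of_sq_le_sq' h hs0
    constructor <;> linarith [this.1, this.2]

lemma antitone_limit (r : ℝ) (q : ℕ → ℝ) (h1 : ∀ n, 1 < q n)
    (hq : ∀ n, q (n + 1) * q n ≤ r * (q n - 1)) (ha : Antitone q) :
    ∃ L : ℝ, L ^ 2 ≤ r * (L - 1) ∧ (∀ n, L ≤ q n) ∧ ∀ a, (∀ n, a ≤ q n) → a ≤ L := by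
  have hb : BddBelow (Set.range q) := ⟨1, by rintro _ ⟨n, rfl⟩; exact (h1 n).le⟩
  have ht := tendsto_atTop_ciInf ha hb
  refine ⟨⨅ n, q n, ?_, fun n => ciInf_le hb n, fun a h => le_ciInf h⟩
  have ht' := (Filter.tendsto_add_atTop_iff_nat 1).2 ht
  have := le_of_tendsto_of_tendsto' (ht'.mul ht) ((ht.sub_const 1).const_mul r) hq
  rw [sq]
  exact this

lemma q_bounds (r : ℝ) (hr : 4 ≤ r) (q : ℕ → ℝ) (h1 : ∀ n, 1 < q n)
    (hq : ∀ n, q (n + 1) * q n ≤ r * (q n - 1)) :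
    (∀ n, zeta1 r ≤ q n) ∧ ∀ z, zeta2 r < z → ∃ N, ∀ n, N ≤ n → q n ≤ z := by
  obtain ⟨hz1, hz12, hz⟩ := zeta_facts r hr
  -- outside of the interval the sequence decreases
  have hdec : ∀ n, (q n < zeta1 r ∨ zeta2 r < q n) → q (n + 1) ≤ q n := by
    intro n hn
    by_contra! hc
    have hp := h1 n
    have := hz (q n) (by nlinarith [hq n])
    rcases hn with h | h <;> linarith [this.1, this.2]
  constructor
  · intro n
    by_contra! hn
    have key : ∀ k, q (n + k) ≤ q n := by
      intro k
      induction k with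
      | zero => exact le_rfl
      | succ k ih => exact (hdec (n + k) (Or.inl (by linarith))).trans ih
    obtain ⟨L, hL, hle, _⟩ := antitone_limit r (fun k => q (n + k)) (fun k => h1 _)
      (fun k => hq (n + k))
      (antitone_nat_of_succ_le fun k => hdec (n + k) (Or.inl (by linarith [key k])))
    have := (hz L hL).1
    have h0 := hle 0
    simp at h0
    linarith
  · intro z hzz
    by_cases hex : ∃ N, q N ≤ z
    · obtain ⟨N, hN⟩ := hex
      refine ⟨N, fun n hn => ?_⟩
      induction n, hn using Nat.le_induction with
      | base => exact hN
      | succ n hn ih =>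
        by_contra! hc
        have hp := h1 n
        have h2 := hq n
        -- z * q n < r * (q n - 1), so z (z) ≤ ...
        have h3 : z * q n < r * (q n - 1) := by nlinarith
        have h4 : z < r := by nlinarith
        have h5 : z ^ 2 ≤ r * (z - 1) := by nlinarith
        linarith [(hz z h5).2]
    · push Not at hex
      obtain ⟨L, hL, _, hge⟩ := antitone_limit r q h1 hq
        (antitone_nat_of_succ_le fun k => hdec k (Or.inr (by linarith [hex k])))
      linarith [(hz L hL).2, hge z fun n => (hex n).le]

/-- Partial sums. -/
noncomputable def psum (X : ℕ → ℝ) (n : ℕ) : ℝ := ∑ j ∈ Finset.range n, X j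

lemma psum_succ (X : ℕ → ℝ) (n : ℕ) : psum X (n + 1) = psum X n + X n := by
  simp [psum, Finset.sum_range_succ]

lemma psum_mono {X : ℕ → ℝ} (h : IsSchedule X) : StrictMono (psum X) :=
  strictMono_nat_of_lt_succ fun n => by rw [psum_succ]; linarith [h.2 n]

lemma psum_pos {X : ℕ → ℝ} (h : IsSchedule X) (n : ℕ) : 0 < psum X (n + 1) := by
  have := psum_mono h (Nat.succ_pos n)
  simpa [psum] using this

lemma psum_ge {X : ℕ → ℝ} (h : IsSchedule X) (n : ℕ) : n * X 0 ≤ psum X n := by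
  induction n with
  | zero => simp [psum]
  | succ n ih =>
    rw [psum_succ]; push_cast
    linarith [h.1.monotone (Nat.zero_le n)]

lemma psum_unbdd {X : ℕ → ℝ} (h : IsSchedule X) (T : ℝ) : ∃ n, T < psum X n := by
  obtain ⟨n, hn⟩ := exists_nat_gt (T / X 0)
  rw [div_lt_iff₀ (h.2 0)] at hn
  exact ⟨n, hn.trans_le (psum_ge h n)⟩

lemma ell_bdd {X : ℕ → ℝ} (h : IsSchedule X) (T : ℝ) :
    BddAbove {y : ℝ | ∃ i : ℕ, y = X i ∧ ∑ j ∈ Finset.range (i + 1), X j ≤ T} := by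
  refine ⟨T, ?_⟩
  rintro _ ⟨i, rfl, hi⟩
  refine le_trans ?_ hi
  exact Finset.single_le_sum (f := X) (fun j _ => (h.2 j).le) (by simp)

lemma ell_nonneg {X : ℕ → ℝ} (h : IsSchedule X) (T : ℝ) : 0 ≤ ell X T := by
  apply Real.sSup_nonneg
  rintro _ ⟨i, rfl, _⟩
  exact (h.2 i).le

lemma ell_mono {X : ℕ → ℝ} (h : IsSchedule X) : Monotone (ell X) := by
  intro T T' hT
  apply Real.sSup_le _ (ell_nonneg h T')
  rintro _ ⟨i, rfl, hi⟩
  exact le_csSup (ell_bdd h T') ⟨i, rfl, hi.trans hT⟩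

lemma ell_le {X : ℕ → ℝ} (h : IsSchedule X) (n : ℕ) (T : ℝ) (hT : T < psum X (n + 2)) :
    ell X T ≤ X n := by
  apply Real.sSup_le _ (h.2 n).le
  rintro _ ⟨i, rfl, hi⟩
  have h1 : psum X (i + 1) < psum X (n + 2) := lt_of_le_of_lt hi hT
  have := (psum_mono h).lt_iff_lt.1 h1
  exact h.1.monotone (by omega)

/-- Log-times at which the processor `X` is good. -/
def goodSet (ρ : ℝ) (X : ℕ → ℝ) : Set ℝ := {t | Real.exp t ≤ ρ * ell X (Real.exp t)}

lemma goodSet_meas (ρ : ℝ) {X : ℕ → ℝ} (h : IsSchedule X) : MeasurableSet (goodSet ρ X) := by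
  have : Measurable fun t => ell X (Real.exp t) :=
    ((ell_mono h).comp Real.exp_monotone).measurable
  exact measurableSet_le Real.measurable_exp (this.const_mul ρ)

open MeasureTheory in
lemma cover_upper (ρ c a : ℝ) (hρ : 0 < ρ) (hc : 0 ≤ c) {X : ℕ → ℝ} (h : IsSchedule X) (N : ℕ)
    (hN : ∀ n, N ≤ n → Real.log (ρ * X (n + 1)) - Real.log (psum X (n + 2)) ≤
      c * (Real.log (psum X (n + 2)) - Real.log (psum X (n + 1)))) :
    ∃ K b0 : ℝ, ∀ b, b0 ≤ b → volume.real (goodSet ρ X ∩ Set.Ico a b) ≤ K + c * b := by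
  set V : ℝ → ℝ := fun b => volume.real (goodSet ρ X ∩ Set.Ico a b) with hV
  have hfin : ∀ b, volume (goodSet ρ X ∩ Set.Ico a b) ≠ ⊤ := fun b =>
    ne_top_of_le_ne_top (by simp) (measure_mono Set.inter_subset_right)
  have step : ∀ n, N ≤ n → V (Real.log (psum X (n + 3))) ≤ V (Real.log (psum X (n + 2))) +
      c * (Real.log (psum X (n + 2)) - Real.log (psum X (n + 1))) := by
    intro n hn
    have hsub : goodSet ρ X ∩ Set.Ico a (Real.log (psum X (n + 3))) ⊆
        (goodSet ρ X ∩ Set.Ico a (Real.log (psum X (n + 2)))) ∪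
          Set.Icc (Real.log (psum X (n + 2))) (Real.log (ρ * X (n + 1))) := by
      rintro t ⟨ht, hta, htb⟩
      by_cases hlt : t < Real.log (psum X (n + 2))
      · exact Or.inl ⟨ht, hta, hlt⟩
      · right
        refine ⟨not_lt.1 hlt, ?_⟩
        rw [Real.le_log_iff_exp_le (mul_pos hρ (h.2 _))]
        refine le_trans ht ?_
        refine mul_le_mul_of_nonneg_left (ell_le h (n + 1) _ ?_) hρ.le
        rwa [Real.lt_log_iff_exp_lt (psum_pos h _)] at htb
    have h1 : V (Real.log (psum X (n + 3))) ≤ _ :=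
      measureReal_mono hsub (measure_union_ne_top (hfin _) (by simp))
    refine h1.trans ((measureReal_union_le _ _).trans ?_)
    gcongr
    rw [Real.volume_real_Icc]
    refine max_le (hN n hn) (mul_nonneg hc ?_)
    have := Real.log_le_log (psum_pos h n) ((psum_mono h).monotone (Nat.le_succ (n + 1)))
    linarith
  have ind : ∀ n, N ≤ n → V (Real.log (psum X (n + 2))) ≤ V (Real.log (psum X (N + 2))) +
      c * (Real.log (psum X (n + 1)) - Real.log (psum X (N + 1))) := by
    intro n hn
    induction n, hn using Nat.le_induction with
    | base => simp
    | succ n hn ih =>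
      have := step n hn
      have e : n + 1 + 2 = n + 3 := rfl
      have e' : n + 1 + 1 = n + 2 := rfl
      rw [e, e']
      linarith
  refine ⟨V (Real.log (psum X (N + 2))) - c * Real.log (psum X (N + 1)),
    Real.log (psum X (N + 1)), fun b hb => ?_⟩
  have hex : ∃ n, Real.exp b < psum X n := psum_unbdd h _
  classical
  have hm := Nat.find_spec hex
  have hmin : ∀ k, k < Nat.find hex → psum X k ≤ Real.exp b := fun k hk =>
    not_lt.1 (Nat.find_min hex hk)
  have hgt : N + 1 < Nat.find hex := by
    by_contra! hle
    have h1 := (psum_mono h).monotone hle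
    have := (Real.log_le_iff_le_exp (psum_pos h N)).1 hb
    linarith
  obtain ⟨n, hn⟩ : ∃ n, Nat.find hex = n + 2 := ⟨Nat.find hex - 2, by omega⟩
  rw [hn] at hm hmin hgt
  have h1 : V b ≤ V (Real.log (psum X (n + 2))) := by
    refine measureReal_mono ?_ (hfin _)
    have : b ≤ Real.log (psum X (n + 2)) := by
      rw [Real.le_log_iff_exp_le (psum_pos h _)]; exact hm.le
    exact Set.inter_subset_inter_right _ (Set.Ico_subset_Ico_right this)
  have h2 := ind n (by omega)
  have h3 : Real.log (psum X (n + 1)) ≤ b :=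
    (Real.log_le_iff_le_exp (psum_pos h n)).2 (hmin (n + 1) (by omega))
  have h4 := mul_le_mul_of_nonneg_left h3 hc
  have : V b ≤ _ := h1.trans h2
  change V b ≤ _
  linarith

open MeasureTheory in
lemma cover_lower {p : ℕ} (B : Fin p → Set ℝ) (hB : ∀ j, MeasurableSet (B j)) (k : ℕ) (a b : ℝ)
    (hab : a ≤ b)
    (hk : ∀ t, a ≤ t → ∃ G : Finset (Fin p), k ≤ G.card ∧ ∀ j ∈ G, t ∈ B j) :
    k * (b - a) ≤ ∑ j, volume.real (B j ∩ Set.Ico a b) := by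
  have hfin : ∀ j, volume (B j ∩ Set.Ico a b) ≠ ⊤ := fun j =>
    ne_top_of_le_ne_top (by simp) (measure_mono Set.inter_subset_right)
  have h1 : ∑ j, volume.real (B j ∩ Set.Ico a b) =
      ∫ t in Set.Ico a b, ∑ j, (B j).indicator (fun _ => (1 : ℝ)) t := by
    rw [integral_finset_sum]
    · refine Finset.sum_congr rfl fun j _ => ?_
      rw [integral_indicator (hB j)]
      simp [measureReal_restrict_apply, hB j, Measure.restrict_restrict]
    · intro j _
      exact (integrable_const (1 : ℝ)).indicator (hB j)
  have h2 : (k : ℝ) * (b - a) = ∫ t in Set.Ico a b, (k : ℝ) := by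
    simp [Real.volume_real_Ico_of_le hab, mul_comm]
  rw [h1, h2]
  refine setIntegral_mono_on (integrable_const _) ?_ measurableSet_Ico ?_
  · exact integrable_finset_sum _ fun j _ => (integrable_const (1 : ℝ)).indicator (hB j)
  · intro t ht
    obtain ⟨G, hG, hGB⟩ := hk t ht.1
    calc (k : ℝ) ≤ G.card := by exact_mod_cast hG
      _ = ∑ j ∈ G, (B j).indicator (fun _ => (1 : ℝ)) t := by
        rw [Finset.sum_congr rfl fun j hj => Set.indicator_of_mem (hGB j hj) _]
        simp
      _ ≤ _ := Finset.sum_le_sum_of_subset_of_nonneg (Finset.subset_univ _)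
        fun j _ _ => Set.indicator_nonneg (fun _ _ => zero_le_one) _

lemma analytic (r : ℝ) (hr : 4 ≤ r) (p f : ℕ) (hp : 1 ≤ p) (ρ : ℝ) (hρ : 0 < ρ)
    (hlt : ρ < sInf ((fun b : ℝ => b ^ (p + f + 1) / (b ^ p - 1)) ''
      Set.Icc (zeta1 r ^ (1 / (p : ℝ))) (zeta2 r ^ (1 / (p : ℝ))))) :
    ∃ c z : ℝ, 0 ≤ c ∧ p * c < f + 1 ∧ zeta2 r < z ∧
      ∀ q, zeta1 r ≤ q → q ≤ z → Real.log ρ + Real.log ((q - 1) / q) ≤ c * Real.log q := by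
  obtain ⟨hz1, hz12, hz⟩ := zeta_facts r hr
  set m := sInf ((fun b : ℝ => b ^ (p + f + 1) / (b ^ p - 1)) ''
      Set.Icc (zeta1 r ^ (1 / (p : ℝ))) (zeta2 r ^ (1 / (p : ℝ)))) with hm
  have hp0 : (0 : ℝ) < p := by exact_mod_cast hp
  have hp1 : (0 : ℝ) ≤ 1 / p := by positivity
  set lam : ℝ := (f + 1) / p with hlam
  have hlam0 : 0 < lam := by positivity
  have hmpos : 0 < m := hρ.trans hlt
  have hbdd : BddBelow ((fun b : ℝ => b ^ (p + f + 1) / (b ^ p - 1)) ''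
      Set.Icc (zeta1 r ^ (1 / (p : ℝ))) (zeta2 r ^ (1 / (p : ℝ)))) := by
    refine ⟨0, ?_⟩
    rintro _ ⟨b, ⟨hb, _⟩, rfl⟩
    have : 1 ≤ b := (Real.one_le_rpow hz1.le hp1).trans hb
    have h2 : 1 ≤ b ^ p := one_le_pow₀ this
    exact div_nonneg (by positivity) (by linarith)
  set H : ℝ → ℝ := fun q => lam * Real.log q - Real.log ((q - 1) / q) with hH
  have key : ∀ q, zeta1 r ≤ q → q ≤ zeta2 r → Real.log m ≤ H q := by
    intro q hq1 hq2
    have hq : 1 < q := hz1.trans_le hq1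
    have hq0 : 0 < q := by linarith
    have hmem : q ^ (1 / (p : ℝ)) ∈
        Set.Icc (zeta1 r ^ (1 / (p : ℝ))) (zeta2 r ^ (1 / (p : ℝ))) :=
      ⟨Real.rpow_le_rpow (by linarith) hq1 hp1, Real.rpow_le_rpow (by linarith) hq2 hp1⟩
    have hle : m ≤ _ := csInf_le hbdd ⟨_, hmem, rfl⟩
    have e1 : (q ^ (1 / (p : ℝ))) ^ p = q := by
      rw [← Real.rpow_natCast, ← Real.rpow_mul hq0.le]
      field_simp
      simp
    have e2 : (q ^ (1 / (p : ℝ))) ^ (p + f + 1) = q * q ^ lam := by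
      rw [add_assoc, pow_add, e1, ← Real.rpow_natCast (q ^ (1 / (p : ℝ))) (f + 1),
        ← Real.rpow_mul hq0.le]
      congr 2
      push_cast
      rw [hlam]; ring
    simp only [e1, e2] at hle
    have hq' : 0 < q - 1 := by linarith
    have := Real.log_le_log hmpos hle
    rw [Real.log_div (by positivity) hq'.ne', Real.log_mul hq0.ne' (by positivity),
      Real.log_rpow hq0] at this
    simp only [hH]
    rw [Real.log_div hq'.ne' hq0.ne']
    linarith
  have hll := Real.log_lt_log hρ hlt
  set δ := (Real.log m - Real.log ρ) / 2 with hδ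
  have hδ0 : 0 < δ := by rw [hδ]; linarith
  have hz2 : 1 < zeta2 r := by linarith
  have hcont : ContinuousAt H (zeta2 r) := by
    have h1 : zeta2 r ≠ 0 := by linarith
    have h2 : (zeta2 r - 1) / zeta2 r ≠ 0 := div_ne_zero (by linarith) h1
    simp only [hH]
    fun_prop (disch := assumption)
  have hev : ∀ᶠ q in nhds (zeta2 r), Real.log m - δ < H q :=
    hcont.eventually (lt_mem_nhds (by linarith [key _ hz12 le_rfl]))
  obtain ⟨ε, hε, hball⟩ := Metric.eventually_nhds_iff.1 hev
  set z := zeta2 r + ε / 2 with hzdef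
  have hlogz : 0 < Real.log z := Real.log_pos (by linarith)
  refine ⟨max 0 (lam - δ / Real.log z), z, le_max_left _ _, ?_, by linarith, ?_⟩
  · have : max 0 (lam - δ / Real.log z) < lam :=
      max_lt hlam0 (by have : 0 < δ / Real.log z := by positivity
                       linarith)
    have h2 := mul_lt_mul_of_pos_left this hp0
    have h3 : (p : ℝ) * lam = f + 1 := by rw [hlam]; field_simp
    linarith
  · intro q hq1 hq2
    have hq : 1 < q := hz1.trans_le hq1
    have hlq := Real.log_pos hq
    have hHq : Real.log m - δ ≤ H q := by
      by_cases h : q ≤ zeta2 r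
      · linarith [key q hq1 h]
      · refine (hball ?_).le
        rw [Real.dist_eq, abs_lt]
        constructor <;> linarith
    have hlog : Real.log q ≤ Real.log z := Real.log_le_log (by linarith) hq2
    have h1 : δ / Real.log z * Real.log q ≤ δ := by
      rw [div_mul_eq_mul_div, div_le_iff₀ hlogz]
      exact mul_le_mul_of_nonneg_left hlog hδ0.le
    have h2 := mul_le_mul_of_nonneg_right (le_max_right 0 (lam - δ / Real.log z)) hlq.le
    simp only [hH] at hHq
    have h3 : 2 * δ = Real.log m - Real.log ρ := by rw [hδ]; ring
    linarith

lemma ratio_bounds (r : ℝ) (hr : 4 ≤ r) {X : ℕ → ℝ} (h : IsSchedule X) (hR : IsRobust r X)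
    (z : ℝ) (hz : zeta2 r < z) :
    ∃ N, ∀ n, N ≤ n → zeta1 r ≤ psum X (n + 2) / psum X (n + 1) ∧
      psum X (n + 2) / psum X (n + 1) ≤ z := by
  have hb := q_bounds r hr (fun n => psum X (n + 2) / psum X (n + 1)) ?_ ?_
  · obtain ⟨N, hN⟩ := hb.2 z hz
    exact ⟨N, fun n hn => ⟨hb.1 n, hN n hn⟩⟩
  · intro n
    rw [one_lt_div (psum_pos h n)]
    exact psum_mono h (by omega)
  · intro n
    have h0 := psum_pos h n
    have h1 := psum_pos h (n + 1)
    have h2 : psum X (n + 3) ≤ r * X (n + 1) := hR.2 (n + 2) (by omega)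
    have h3 : psum X (n + 2) = psum X (n + 1) + X (n + 1) := psum_succ X (n + 1)
    have e : psum X (n + 1 + 2) / psum X (n + 1 + 1) * (psum X (n + 2) / psum X (n + 1)) =
        psum X (n + 3) / psum X (n + 1) := by
      change psum X (n + 3) / psum X (n + 2) * (psum X (n + 2) / psum X (n + 1)) = _
      have h1' : psum X (n + 2) ≠ 0 := h1.ne'
      field_simp
    have e2 : r * (psum X (n + 2) / psum X (n + 1) - 1) = r * X (n + 1) / psum X (n + 1) := by
      rw [h3]; field_simp; ring
    change psum X (n + 1 + 2) / psum X (n + 1 + 1) * (psum X (n + 2) / psum X (n + 1)) ≤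
      r * (psum X (n + 2) / psum X (n + 1) - 1)
    rw [e, e2]
    gcongr

theorem stmt_16 (r : ℝ) (hr : 4 ≤ r) (p f : ℕ) (hp : 1 ≤ p) (hf : f < p)
    (X : Fin p → ℕ → ℝ)
    (hsched : ∀ j, IsSchedule (X j))
    (hrob : ∀ j, IsRobust r (X j))
    (ρ : ℝ)
    (hρ : ∀ S : Finset (Fin p), S.card = p - f → ∀ T : ℝ,
      sInf (↑(S.image fun j => X j 0) : Set ℝ) ≤ T →
      T ≤ ρ * sSup (↑(S.image fun j => ell (X j) T) : Set ℝ)) :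
    sInf ((fun b : ℝ => b ^ (p + f + 1) / (b ^ p - 1)) ''
      Set.Icc (zeta1 r ^ (1 / (p : ℝ))) (zeta2 r ^ (1 / (p : ℝ)))) ≤ ρ := by
  have hcov : ∀ T : ℝ, (∀ j, X j 0 ≤ T) → ∃ G : Finset (Fin p), f + 1 ≤ G.card ∧
      ∀ j ∈ G, T ≤ ρ * ell (X j) T := by
    intro T hT
    classical
    refine ⟨Finset.univ.filter fun j => T ≤ ρ * ell (X j) T, ?_, by simp⟩
    by_contra! hc
    have hcard := Finset.card_filter_add_card_filter_not (s := (Finset.univ : Finset (Fin p)))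
      (fun j => T ≤ ρ * ell (X j) T)
    rw [Finset.card_univ, Fintype.card_fin] at hcard
    obtain ⟨S, hS, hSc⟩ := Finset.exists_subset_card_eq
      (s := Finset.univ.filter fun j => ¬ T ≤ ρ * ell (X j) T) (n := p - f) (by omega)
    have hne : S.Nonempty := Finset.card_pos.1 (by omega)
    obtain ⟨j0, hj0⟩ := hne
    have h1 := hρ S hSc T ((csInf_le (Finset.bddBelow _)
      (Finset.mem_coe.2 (Finset.mem_image_of_mem _ hj0))).trans (hT j0))
    have hmem := Set.Nonempty.csSup_mem
      (s := (↑(S.image fun j => ell (X j) T) : Set ℝ))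
      ⟨_, Finset.mem_coe.2 (Finset.mem_image_of_mem _ hj0)⟩ (Finset.finite_toSet _)
    obtain ⟨j, hj, he⟩ := Finset.mem_image.1 (Finset.mem_coe.1 hmem)
    rw [← he] at h1
    exact (Finset.mem_filter.1 (hS hj)).2 h1
  obtain ⟨T0, hT0⟩ : ∃ T0 : ℝ, ∀ j, X j 0 ≤ T0 :=
    ⟨∑ j, X j 0, fun j => Finset.single_le_sum (f := fun j => X j 0)
      (fun j _ => ((hsched j).2 0).le) (Finset.mem_univ j)⟩
  have hT0pos : 0 < T0 := ((hsched ⟨0, hp⟩).2 0).trans_le (hT0 _)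
  have hρ0 : 0 < ρ := by
    obtain ⟨G, hG, hGj⟩ := hcov T0 hT0
    obtain ⟨j, hj⟩ := Finset.card_pos.1 (by omega : 0 < G.card)
    exact pos_of_mul_pos_left (hT0pos.trans_le (hGj j hj)) (ell_nonneg (hsched j) T0)
  by_contra! hlt
  obtain ⟨c, z, hc0, hc, hz, hq⟩ := analytic r hr p f hp ρ hρ0 hlt
  have hz1 := (zeta_facts r hr).1
  have hup : ∀ j, ∃ K b0 : ℝ, ∀ b, b0 ≤ b →
      MeasureTheory.volume.real (goodSet ρ (X j) ∩ Set.Ico (Real.log T0) b) ≤ K + c * b := by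
    intro j
    obtain ⟨N, hN⟩ := ratio_bounds r hr (hsched j) (hrob j) z hz
    refine cover_upper ρ c _ hρ0 hc0 (hsched j) N fun n hn => ?_
    have h0 := psum_pos (hsched j) n
    have h1 : 0 < psum (X j) (n + 2) := psum_pos (hsched j) (n + 1)
    have h3 : psum (X j) (n + 2) = psum (X j) (n + 1) + X j (n + 1) := psum_succ (X j) (n + 1)
    have hx := (hsched j).2 (n + 1)
    have := hq _ (hN n hn).1 (hN n hn).2
    have e : (psum (X j) (n + 2) / psum (X j) (n + 1) - 1) /
        (psum (X j) (n + 2) / psum (X j) (n + 1)) = X j (n + 1) / psum (X j) (n + 2) := by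
      have e' : X j (n + 1) = psum (X j) (n + 2) - psum (X j) (n + 1) := by linarith
      rw [e']
      field_simp
    rw [e, Real.log_div hx.ne' h1.ne', Real.log_div h1.ne' h0.ne'] at this
    rw [Real.log_mul hρ0.ne' hx.ne']
    linarith
  choose K b0 hK using hup
  have hlow : ∀ b, Real.log T0 ≤ b → ((f + 1 : ℕ) : ℝ) * (b - Real.log T0) ≤
      ∑ j, MeasureTheory.volume.real (goodSet ρ (X j) ∩ Set.Ico (Real.log T0) b) := by
    intro b hb
    refine cover_lower _ (fun j => goodSet_meas ρ (hsched j)) (f + 1) _ b hb fun t ht => ?_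
    have := (Real.log_le_iff_le_exp hT0pos).1 ht
    exact hcov (Real.exp t) fun j => (hT0 j).trans this
  have hall : ∀ᶠ b : ℝ in Filter.atTop, ((f + 1 : ℕ) : ℝ) * (b - Real.log T0) ≤
      (∑ j, K j) + p * c * b := by
    have h1 : ∀ᶠ b : ℝ in Filter.atTop, ∀ j, b0 j ≤ b :=
      Filter.eventually_all.2 fun j => Filter.eventually_ge_atTop _
    filter_upwards [h1, Filter.eventually_ge_atTop (Real.log T0)] with b hb hb'
    refine (hlow b hb').trans ((Finset.sum_le_sum fun j _ => hK j b (hb j)).trans ?_)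
    rw [Finset.sum_add_distrib]
    simp [mul_assoc]
  have hd : 0 < (f : ℝ) + 1 - p * c := by linarith
  obtain ⟨b, hb, hb2⟩ := (hall.and (Filter.eventually_gt_atTop
    (((∑ j, K j) + (f + 1) * Real.log T0) / (f + 1 - p * c)))).exists
  rw [div_lt_iff₀ hd] at hb2
  push_cast at hb
  linarith
end
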